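/- arXiv:2004.03487 — 9 statements merged into one kernel-verified Lean document; each statement's English description precedes it below -/
import Mathlib

section
/- Consider the COVID-19 model with lockdown. Let (S,L,E,A,I,C,R) : ℝ → ℝ^7 be differentiable functions on [0,∞) satisfying the system, and suppose N(t) − L(t) − C(t) > 0 for all t ≥ 0 (so the right-hand side is defined). If S(0) ≥ 0, L(0) ≥ 0, E(0) ≥ 0, A(0) ≥ 0, I(0) ≥ 0, C(0) ≥ 0, R(0) ≥ 0, then S(t) ≥ 0, L(t) ≥ 0, E(t) ≥ 0, A(t) ≥ 0, I(t) ≥ 0, C(t) ≥ 0 and R(t) ≥ 0 for all t ≥ 0; that is, the nonnegative orthant ℝ₊^7 is invariant for the system. -/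
lemma hasDerivAt_minSq (u : ℝ) : HasDerivAt (fun v : ℝ => (min v 0)^2) (2 * min u 0) u := by
  rw [hasDerivAt_iff_isLittleO]
  have h1 : (fun v : ℝ => (min v 0)^2 - (min u 0)^2 - (v - u) • (2 * min u 0))
      =O[nhds u] (fun v : ℝ => (v - u)^2) := by
    apply Asymptotics.IsBigO.of_bound 1
    refine Filter.Eventually.of_forall fun v => ?_
    rw [Real.norm_eq_abs, Real.norm_eq_abs, abs_of_nonneg (sq_nonneg (v - u)), one_mul, smul_eq_mul,
      abs_le]
    rcases le_total u 0 with hu | hu <;> rcases le_total v 0 with hv | hv <;>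
      simp only [min_eq_left, min_eq_right, hu, hv] <;> constructor <;>
      nlinarith [sq_nonneg (u - v), mul_nonneg_of_nonpos_of_nonpos (a := u) (b := u), mul_nonpos_of_nonpos_of_nonneg (a := u) (b := v), mul_nonpos_of_nonneg_of_nonpos (a := u) (b := v), sq_nonneg u, sq_nonneg v]
  refine h1.trans_isLittleO ?_
  have h2 : (fun v : ℝ => v - u) =o[nhds u] (fun _ : ℝ => (1:ℝ)) := by
    rw [Asymptotics.isLittleO_one_iff]
    have : Filter.Tendsto (fun v : ℝ => v - u) (nhds u) (nhds (u - u)) :=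
      (continuous_id.sub continuous_const).tendsto u
    simpa using this
  have h3 := h2.mul_isBigO (Asymptotics.isBigO_refl (fun v : ℝ => v - u) (nhds u))
  simpa [pow_two] using h3

lemma nonneg_three (x y z f g h : ℝ → ℝ) (T M : ℝ) (hT : 0 ≤ T)
    (hx : ∀ t ≥ (0:ℝ), HasDerivAt x (f t) t) (hy : ∀ t ≥ (0:ℝ), HasDerivAt y (g t) t)
    (hz : ∀ t ≥ (0:ℝ), HasDerivAt z (h t) t)
    (hx0 : 0 ≤ x 0) (hy0 : 0 ≤ y 0) (hz0 : 0 ≤ z 0)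
    (hb : ∀ t ∈ Set.Icc 0 T, min (x t) 0 * f t + min (y t) 0 * g t + min (z t) 0 * h t
      ≤ M * ((min (x t) 0)^2 + (min (y t) 0)^2 + (min (z t) 0)^2)) :
    0 ≤ x T ∧ 0 ≤ y T ∧ 0 ≤ z T := by
  set V : ℝ → ℝ := fun t => (min (x t) 0)^2 + (min (y t) 0)^2 + (min (z t) 0)^2 with hV
  have hVd : ∀ t ≥ (0:ℝ), HasDerivAt V (2 * min (x t) 0 * f t + 2 * min (y t) 0 * g t
      + 2 * min (z t) 0 * h t) t := fun t ht =>
    (((hasDerivAt_minSq (x t)).comp t (hx t ht)).add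
      ((hasDerivAt_minSq (y t)).comp t (hy t ht))).add ((hasDerivAt_minSq (z t)).comp t (hz t ht))
  have hed : ∀ t : ℝ, HasDerivAt (fun t => Real.exp (-(2*M)*t)) (Real.exp (-(2*M)*t) * (-(2*M))) t :=
    fun t => by simpa using ((hasDerivAt_id t).const_mul (-(2*M))).exp
  have hWd := fun t (ht : t ≥ (0:ℝ)) => (hVd t ht).mul (hed t)
  have hanti : AntitoneOn (V * fun t => Real.exp (-(2*M)*t)) (Set.Icc 0 T) := by
    apply antitoneOn_of_deriv_nonpos (convex_Icc 0 T)
    · exact fun t ht => (hWd t ht.1).continuousAt.continuousWithinAt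
    · intro t ht
      rw [interior_Icc] at ht
      exact (hWd t ht.1.le).differentiableAt.differentiableWithinAt
    · intro t ht
      rw [interior_Icc] at ht
      rw [(hWd t ht.1.le).deriv]
      have h1 := hb t ⟨ht.1.le, ht.2.le⟩
      have h2 : V t = (min (x t) 0)^2 + (min (y t) 0)^2 + (min (z t) 0)^2 := rfl
      rw [← h2] at h1
      nlinarith [mul_le_mul_of_nonneg_right h1 (Real.exp_pos (-(2*M)*t)).le]
  have h0 := hanti (Set.left_mem_Icc.2 hT) (Set.right_mem_Icc.2 hT) hT
  have hV0 : V 0 = 0 := by simp [hV, hx0, hy0, hz0]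
  simp only [Pi.mul_apply, hV0, zero_mul] at h0
  have h1 : V T ≤ 0 := by
    by_contra hc
    push Not at hc
    linarith [mul_pos hc (Real.exp_pos (-(2*M)*T))]
  have h2 : V T = (min (x T) 0)^2 + (min (y T) 0)^2 + (min (z T) 0)^2 := rfl
  rw [h2] at h1
  refine ⟨?_, ?_, ?_⟩
  · have : (min (x T) 0)^2 = 0 := by nlinarith [sq_nonneg (min (x T) 0), sq_nonneg (min (y T) 0), sq_nonneg (min (z T) 0)]
    exact min_eq_right_iff.1 (pow_eq_zero_iff two_ne_zero |>.1 this)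
  · have : (min (y T) 0)^2 = 0 := by nlinarith [sq_nonneg (min (x T) 0), sq_nonneg (min (y T) 0), sq_nonneg (min (z T) 0)]
    exact min_eq_right_iff.1 (pow_eq_zero_iff two_ne_zero |>.1 this)
  · have : (min (z T) 0)^2 = 0 := by nlinarith [sq_nonneg (min (x T) 0), sq_nonneg (min (y T) 0), sq_nonneg (min (z T) 0)]
    exact min_eq_right_iff.1 (pow_eq_zero_iff two_ne_zero |>.1 this)

/-- scalar diagonal term -/
lemma min_mul_self' (u : ℝ) : min u 0 * u = (min u 0)^2 := by
  rcases le_total u 0 with hu | hu <;> simp [hu, pow_two]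

/-- cooperative cross term -/
lemma cross_le (u v c M : ℝ) (hc : 0 ≤ c) (hM : c ≤ M) :
    min u 0 * (c * v) ≤ M * ((min u 0)^2 + (min v 0)^2) := by
  have h1 : min u 0 ≤ 0 := min_le_right _ _
  have h2 : min v 0 ≤ v := min_le_left _ _
  have h3 : min v 0 ≤ 0 := min_le_right _ _
  have h4 : min u 0 * v ≤ min u 0 * min v 0 := mul_le_mul_of_nonpos_left h2 h1
  have h5 : min u 0 * min v 0 ≤ (min u 0)^2 + (min v 0)^2 := by
    nlinarith [sq_nonneg (min u 0 - min v 0), sq_nonneg (min u 0), sq_nonneg (min v 0)]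
  have h6 : 0 ≤ (min u 0)^2 + (min v 0)^2 := by positivity
  calc min u 0 * (c * v) = c * (min u 0 * v) := by ring
    _ ≤ c * ((min u 0)^2 + (min v 0)^2) := mul_le_mul_of_nonneg_left (h4.trans h5) hc
    _ ≤ _ := mul_le_mul_of_nonneg_right hM h6

lemma nonneg_one (x f g : ℝ → ℝ) (k : ℝ) (hk : 0 ≤ k)
    (hx : ∀ t ≥ (0:ℝ), HasDerivAt x (f t) t) (hf : ∀ t ≥ (0:ℝ), f t = g t - k * x t)
    (hg : ∀ t ≥ (0:ℝ), 0 ≤ g t) (hx0 : 0 ≤ x 0) : ∀ T ≥ (0:ℝ), 0 ≤ x T := by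
  intro T hT
  refine (nonneg_three x (fun _ => 0) (fun _ => 0) f (fun _ => 0) (fun _ => 0) T 0 hT hx
    (fun t _ => hasDerivAt_const t 0) (fun t _ => hasDerivAt_const t 0) hx0 le_rfl le_rfl ?_).1
  intro t ht
  rw [hf t ht.1]
  have h1 := mul_nonpos_of_nonpos_of_nonneg (min_le_right (x t) 0) (hg t ht.1)
  have h2 := mul_nonneg hk (sq_nonneg (min (x t) 0))
  rw [← min_mul_self'] at h2
  simp only [mul_zero, zero_mul, add_zero]
  nlinarith

/-- Positivity of solutions for the COVID-19 model with lockdown: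
the nonnegative orthant `ℝ₊^7` is invariant. -/
theorem stmt_0
    (PiH μ β1 σ γ1 γ2 γ3 τ δ l ω ρ κ : ℝ)
    (hPiH : 0 < PiH) (hμ : 0 < μ) (hβ1 : 0 < β1) (hσ : 0 < σ)
    (hγ1 : 0 < γ1) (hγ2 : 0 < γ2) (hγ3 : 0 < γ3) (hτ : 0 < τ)
    (hδ : 0 < δ) (hl : 0 < l) (hω : 0 < ω)
    (hρ0 : 0 ≤ ρ) (hρ1 : ρ ≤ 1) (hκ0 : 0 < κ) (hκ1 : κ < 1)
    (S L E A I C R N : ℝ → ℝ)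
    (hN : ∀ t, N t = S t + L t + E t + A t + I t + C t + R t)
    (hpos : ∀ t ≥ (0:ℝ), 0 < N t - L t - C t)
    (hS : ∀ t ≥ (0:ℝ), HasDerivAt S (PiH + ω * L t
      - β1 * I t * S t / (N t - L t - C t)
      - ρ * β1 * A t * S t / (N t - L t - C t) - μ * S t - l * S t) t)
    (hL : ∀ t ≥ (0:ℝ), HasDerivAt L (l * S t - (μ + ω) * L t) t)
    (hE : ∀ t ≥ (0:ℝ), HasDerivAt E (β1 * I t * S t / (N t - L t - C t)
      + ρ * β1 * A t * S t / (N t - L t - C t) - (μ + σ) * E t) t)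
    (hA : ∀ t ≥ (0:ℝ), HasDerivAt A ((1 - κ) * σ * E t - (γ1 + μ) * A t) t)
    (hI : ∀ t ≥ (0:ℝ), HasDerivAt I (κ * σ * E t - (γ2 + τ + μ) * I t) t)
    (hC : ∀ t ≥ (0:ℝ), HasDerivAt C (τ * I t - (δ + γ3 + μ) * C t) t)
    (hR : ∀ t ≥ (0:ℝ), HasDerivAt R (γ1 * A t + γ2 * I t + γ3 * C t - μ * R t) t)
    (hS0 : 0 ≤ S 0) (hL0 : 0 ≤ L 0) (hE0 : 0 ≤ E 0) (hA0 : 0 ≤ A 0)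
    (hI0 : 0 ≤ I 0) (hC0 : 0 ≤ C 0) (hR0 : 0 ≤ R 0) :
    ∀ t ≥ (0:ℝ), 0 ≤ S t ∧ 0 ≤ L t ∧ 0 ≤ E t ∧ 0 ≤ A t ∧ 0 ≤ I t ∧ 0 ≤ C t ∧ 0 ≤ R t := by
  have hw : ContinuousOn (fun t => N t - L t - C t) (Set.Ici 0) := by
    have : (fun t => N t - L t - C t) = fun t => S t + E t + A t + I t + R t := by
      funext t; rw [hN]; ring
    rw [this]
    intro t ht
    exact (((((hS t ht).continuousAt.add (hE t ht).continuousAt).add (hA t ht).continuousAt).add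
      (hI t ht).continuousAt).add (hR t ht).continuousAt).continuousWithinAt
  have cS : ContinuousOn S (Set.Ici 0) := fun t ht => (hS t ht).continuousAt.continuousWithinAt
  have cA : ContinuousOn A (Set.Ici 0) := fun t ht => (hA t ht).continuousAt.continuousWithinAt
  have cI : ContinuousOn I (Set.Ici 0) := fun t ht => (hI t ht).continuousAt.continuousWithinAt
  have hSL : ∀ T ≥ (0:ℝ), 0 ≤ S T ∧ 0 ≤ L T := by
    intro T hT
    have ca : ContinuousOn (fun t => (β1 * I t + ρ * β1 * A t) / (N t - L t - C t)) (Set.Icc 0 T) :=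
      (((continuousOn_const.mul cI).add (continuousOn_const.mul cA)).div hw
        (fun t ht => (hpos t ht).ne')).mono Set.Icc_subset_Ici_self
    obtain ⟨M, hM⟩ := isCompact_Icc.exists_bound_of_continuousOn ca
    have h := nonneg_three S L (fun _ => 0) _ _ (fun _ => 0) T (M + ω + l) hT hS hL
      (fun t _ => hasDerivAt_const t 0) hS0 hL0 le_rfl ?_
    · exact ⟨h.1, h.2.1⟩
    intro t ht
    have hMt := hM t ht
    rw [Real.norm_eq_abs, abs_le] at hMt
    set a := (β1 * I t + ρ * β1 * A t) / (N t - L t - C t) with ha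
    have e : PiH + ω * L t - β1 * I t * S t / (N t - L t - C t)
      - ρ * β1 * A t * S t / (N t - L t - C t) - μ * S t - l * S t
      = PiH + ω * L t - (a + μ + l) * S t := by rw [ha]; ring
    rw [e]
    have h1 := cross_le (S t) (L t) ω ω hω.le le_rfl
    have h2 := cross_le (L t) (S t) l l hl.le le_rfl
    have h3 := min_mul_self' (S t)
    have h4 := min_mul_self' (L t)
    have h5 := mul_nonneg hPiH.le (neg_nonneg.2 (min_le_right (S t) 0))
    have h6 : 0 ≤ (M + a) * (min (S t) 0)^2 := mul_nonneg (by linarith) (sq_nonneg _)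
    have h7 : 0 ≤ (μ + l) * (min (S t) 0)^2 := by positivity
    have h8 : 0 ≤ (μ + ω) * (min (L t) 0)^2 := by positivity
    have h9 : 0 ≤ M * (min (L t) 0)^2 := mul_nonneg (by linarith) (sq_nonneg _)
    have e2 : min (S t) 0 * (PiH + ω * L t - (a + μ + l) * S t) = min (S t) 0 * PiH
      + min (S t) 0 * (ω * L t) - (a + μ + l) * (min (S t) 0)^2 := by rw [← h3]; ring
    have e3 : min (L t) 0 * (l * S t - (μ + ω) * L t) = min (L t) 0 * (l * S t)
      - (μ + ω) * (min (L t) 0)^2 := by rw [← h4]; ring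
    rw [e2, e3]
    simp only [min_self]
    linarith
  have hEAI : ∀ T ≥ (0:ℝ), 0 ≤ E T ∧ 0 ≤ A T ∧ 0 ≤ I T := by
    intro T hT
    have ca : ContinuousOn (fun t => β1 * S t / (N t - L t - C t)) (Set.Icc 0 T) :=
      ((continuousOn_const.mul cS).div hw
        (fun t ht => (hpos t ht).ne')).mono Set.Icc_subset_Ici_self
    obtain ⟨M, hM⟩ := isCompact_Icc.exists_bound_of_continuousOn ca
    refine nonneg_three E A I _ _ _ T (2 * M + (1 - κ) * σ + κ * σ) hT hE hA hI hE0 hA0 hI0 ?_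
    intro t ht
    have hMt := hM t ht
    rw [Real.norm_eq_abs, abs_le] at hMt
    have hb0 : 0 ≤ β1 * S t / (N t - L t - C t) :=
      div_nonneg (mul_nonneg hβ1.le (hSL t ht.1).1) (hpos t ht.1).le
    set b := β1 * S t / (N t - L t - C t) with hb
    have e : β1 * I t * S t / (N t - L t - C t)
      + ρ * β1 * A t * S t / (N t - L t - C t) - (μ + σ) * E t
      = b * I t + (ρ * b) * A t - (μ + σ) * E t := by rw [hb]; ring
    rw [e]
    have hM0 : 0 ≤ M := by linarith
    have hκ : 0 < 1 - κ := by linarith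
    have h1 := cross_le (E t) (I t) b M hb0 hMt.2
    have h2 := cross_le (E t) (A t) (ρ * b) M (by positivity) (by nlinarith)
    have h3 := cross_le (A t) (E t) ((1 - κ) * σ) _ (by positivity) le_rfl
    have h4 := cross_le (I t) (E t) (κ * σ) _ (by positivity) le_rfl
    have e2 : min (E t) 0 * (b * I t + (ρ * b) * A t - (μ + σ) * E t) = min (E t) 0 * (b * I t)
      + min (E t) 0 * ((ρ * b) * A t) - (μ + σ) * (min (E t) 0)^2 := by
      rw [← min_mul_self' (E t)]; ring
    have e3 : min (A t) 0 * ((1 - κ) * σ * E t - (γ1 + μ) * A t)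
      = min (A t) 0 * ((1 - κ) * σ * E t) - (γ1 + μ) * (min (A t) 0)^2 := by
      rw [← min_mul_self' (A t)]; ring
    have e4 : min (I t) 0 * (κ * σ * E t - (γ2 + τ + μ) * I t)
      = min (I t) 0 * (κ * σ * E t) - (γ2 + τ + μ) * (min (I t) 0)^2 := by
      rw [← min_mul_self' (I t)]; ring
    rw [e2, e3, e4]
    have p1 : 0 ≤ (μ + σ) * (min (E t) 0)^2 := by positivity
    have p2 : 0 ≤ (γ1 + μ) * (min (A t) 0)^2 := by positivity
    have p3 : 0 ≤ (γ2 + τ + μ) * (min (I t) 0)^2 := by positivity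
    have p4 : 0 ≤ M * (min (A t) 0)^2 := by positivity
    have p5 : 0 ≤ M * (min (I t) 0)^2 := by positivity
    have p6 : 0 ≤ ((1 - κ) * σ) * (min (I t) 0)^2 := by positivity
    have p7 : 0 ≤ (κ * σ) * (min (A t) 0)^2 := by positivity
    linarith
  have hC' : ∀ T ≥ (0:ℝ), 0 ≤ C T :=
    nonneg_one C _ (fun t => τ * I t) (δ + γ3 + μ) (by positivity) hC (fun t _ => rfl)
      (fun t ht => mul_nonneg hτ.le (hEAI t ht).2.2) hC0
  have hR' : ∀ T ≥ (0:ℝ), 0 ≤ R T :=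
    nonneg_one R _ (fun t => γ1 * A t + γ2 * I t + γ3 * C t) μ hμ.le hR (fun t _ => rfl)
      (fun t ht => by
        have h1 := mul_nonneg hγ1.le (hEAI t ht).2.1
        have h2 := mul_nonneg hγ2.le (hEAI t ht).2.2
        have h3 := mul_nonneg hγ3.le (hC' t ht)
        show 0 ≤ γ1 * A t + γ2 * I t + γ3 * C t
        linarith) hR0
  intro t ht
  exact ⟨(hSL t ht).1, (hSL t ht).2, (hEAI t ht).1, (hEAI t ht).2.1, (hEAI t ht).2.2, hC' t ht,
    hR' t ht⟩
end

section
/- Consider the COVID-19 model with lockdown. Let (S,L,E,A,I,C,R) be a differentiable solution on [0,∞) whose components are all nonnegative and with N(t) − L(t) − C(t) > 0 for all t ≥ 0, and set N = S+L+E+A+I+C+R. Then N'(t) = ΠH − μ N(t) − δ C(t) ≤ ΠH − μ N(t) for all t ≥ 0, and consequently limsup_{t→∞} N(t) ≤ ΠH/μ. -/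
/-- Boundedness for the COVID-19 model with lockdown:
`N' = PiH - μN - δC ≤ PiH - μN`, hence `limsup N ≤ PiH/μ`. -/
theorem stmt_2
    (PiH μ β1 σ γ1 γ2 γ3 τ δ l ω ρ κ : ℝ)
    (hPiH : 0 < PiH) (hμ : 0 < μ) (hβ1 : 0 < β1) (hσ : 0 < σ)
    (hγ1 : 0 < γ1) (hγ2 : 0 < γ2) (hγ3 : 0 < γ3) (hτ : 0 < τ)
    (hδ : 0 < δ) (hl : 0 < l) (hω : 0 < ω)
    (hρ0 : 0 ≤ ρ) (hρ1 : ρ ≤ 1) (hκ0 : 0 < κ) (hκ1 : κ < 1)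
    (S L E A I C R N : ℝ → ℝ)
    (hN : ∀ t, N t = S t + L t + E t + A t + I t + C t + R t)
    (hnonneg : ∀ t ≥ (0:ℝ), 0 ≤ S t ∧ 0 ≤ L t ∧ 0 ≤ E t ∧ 0 ≤ A t ∧ 0 ≤ I t ∧ 0 ≤ C t ∧ 0 ≤ R t)
    (hpos : ∀ t ≥ (0:ℝ), 0 < N t - L t - C t)
    (hS : ∀ t ≥ (0:ℝ), HasDerivAt S (PiH + ω * L t
      - β1 * I t * S t / (N t - L t - C t)
      - ρ * β1 * A t * S t / (N t - L t - C t) - μ * S t - l * S t) t)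
    (hL : ∀ t ≥ (0:ℝ), HasDerivAt L (l * S t - (μ + ω) * L t) t)
    (hE : ∀ t ≥ (0:ℝ), HasDerivAt E (β1 * I t * S t / (N t - L t - C t)
      + ρ * β1 * A t * S t / (N t - L t - C t) - (μ + σ) * E t) t)
    (hA : ∀ t ≥ (0:ℝ), HasDerivAt A ((1 - κ) * σ * E t - (γ1 + μ) * A t) t)
    (hI : ∀ t ≥ (0:ℝ), HasDerivAt I (κ * σ * E t - (γ2 + τ + μ) * I t) t)
    (hC : ∀ t ≥ (0:ℝ), HasDerivAt C (τ * I t - (δ + γ3 + μ) * C t) t)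
    (hR : ∀ t ≥ (0:ℝ), HasDerivAt R (γ1 * A t + γ2 * I t + γ3 * C t - μ * R t) t) :
    (∀ t ≥ (0:ℝ), HasDerivAt N (PiH - μ * N t - δ * C t) t ∧
      PiH - μ * N t - δ * C t ≤ PiH - μ * N t) ∧
    Filter.limsup N Filter.atTop ≤ PiH / μ := by
  have hNd : ∀ t ≥ (0:ℝ), HasDerivAt N (PiH - μ * N t - δ * C t) t := by
    intro t ht
    have h := ((((((hS t ht).add (hL t ht)).add (hE t ht)).add (hA t ht)).add (hI t ht)).add
      (hC t ht)).add (hR t ht)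
    have hfun : N = S + L + E + A + I + C + R := by
      funext x
      simpa using hN x
    have hval := hN t
    rw [← hfun] at h
    refine h.congr_deriv ?_
    generalize β1 * I t * S t / (N t - L t - C t) = u
    generalize ρ * β1 * A t * S t / (N t - L t - C t) = v
    rw [hval]
    ring
  have hle : ∀ t ≥ (0:ℝ), PiH - μ * N t - δ * C t ≤ PiH - μ * N t := by
    intro t ht
    have hCt : 0 ≤ C t := (hnonneg t ht).2.2.2.2.2.1
    have := mul_nonneg hδ.le hCt
    linarith
  refine ⟨fun t ht => ⟨hNd t ht, hle t ht⟩, ?_⟩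
  have hg : ∀ t ≥ (0:ℝ), HasDerivAt (fun t => (N t - PiH / μ) * Real.exp (μ * t))
      (-(δ * C t) * Real.exp (μ * t)) t := by
    intro t ht
    have h1 : HasDerivAt (fun t => Real.exp (μ * t)) (Real.exp (μ * t) * (μ * 1)) t :=
      ((hasDerivAt_id t).const_mul μ).exp
    have h2 := ((hNd t ht).sub_const (PiH / μ)).mul h1
    refine h2.congr_deriv ?_
    field_simp
    ring
  have hanti : AntitoneOn (fun t => (N t - PiH / μ) * Real.exp (μ * t)) (Set.Ici 0) := by
    apply antitoneOn_of_deriv_nonpos (convex_Ici 0)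
    · intro t ht
      exact (hg t ht).continuousAt.continuousWithinAt
    · intro t ht
      rw [interior_Ici] at ht
      exact (hg t (le_of_lt ht)).differentiableAt.differentiableWithinAt
    · intro t ht
      rw [interior_Ici] at ht
      have ht' : (0:ℝ) ≤ t := le_of_lt ht
      rw [(hg t ht').deriv]
      have hCt : 0 ≤ C t := (hnonneg t ht').2.2.2.2.2.1
      have := mul_nonneg (mul_nonneg hδ.le hCt) (Real.exp_pos (μ * t)).le
      linarith
  have hbound : ∀ t ≥ (0:ℝ), N t ≤ PiH / μ + (N 0 - PiH / μ) * Real.exp (-(μ * t)) := by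
    intro t ht
    have h := hanti (Set.mem_Ici.2 le_rfl) (Set.mem_Ici.2 ht) ht
    simp only [mul_zero, Real.exp_zero, mul_one] at h
    have h3 := mul_le_mul_of_nonneg_right h (Real.exp_pos (-(μ * t))).le
    rw [mul_assoc, ← Real.exp_add, add_neg_cancel, Real.exp_zero, mul_one] at h3
    linarith
  have hlim : Filter.Tendsto (fun t => PiH / μ + (N 0 - PiH / μ) * Real.exp (-(μ * t)))
      Filter.atTop (nhds (PiH / μ)) := by
    have h1 : Filter.Tendsto (fun t : ℝ => Real.exp (-(μ * t))) Filter.atTop (nhds 0) :=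
      Real.tendsto_exp_neg_atTop_nhds_zero.comp (Filter.tendsto_id.const_mul_atTop hμ)
    simpa using (h1.const_mul (N 0 - PiH / μ)).const_add (PiH / μ)
  have hN0 : ∀ t ≥ (0:ℝ), 0 ≤ N t := by
    intro t ht
    obtain ⟨h1, h2, h3, h4, h5, h6, h7⟩ := hnonneg t ht
    rw [hN t]
    positivity
  rw [← hlim.limsup_eq]
  refine Filter.limsup_le_limsup ?_ ?_ hlim.isBoundedUnder_le
  · filter_upwards [Filter.eventually_ge_atTop (0:ℝ)] with t ht using hbound t ht
  · refine Filter.IsBoundedUnder.isCoboundedUnder_le ⟨0, ?_⟩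
    rw [Filter.eventually_map]
    filter_upwards [Filter.eventually_ge_atTop (0:ℝ)] with t ht using hN0 t ht
end

section
/- Let J be the 7×7 real matrix with rows: (−(μ+l), ω, 0, −ρβ1, −β1, 0, 0), (l, −(μ+ω), 0, 0, 0, 0, 0), (0, 0, −(μ+σ), ρβ1, β1, 0, 0), (0, 0, (1−κ)σ, −(μ+γ1), 0, 0, 0), (0, 0, κσ, 0, −(μ+γ2+τ), 0, 0), (0, 0, 0, 0, τ, −(μ+γ3+δ), 0), (0, 0, 0, γ1, γ2, γ3, −μ). If R0 < 1, then every complex eigenvalue of J has negative real part (so the disease-free equilibrium of the model with lockdown is locally asymptotically stable). -/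
theorem aux_ne (z : ℂ) (hz : 0 ≤ z.re) (a : ℝ) (ha : 0 < a) : z + (a : ℂ) ≠ 0 := by
  intro h
  have := congrArg Complex.re h
  simp at this
  linarith

theorem aux_norm (z : ℂ) (hz : 0 ≤ z.re) (a : ℝ) : a ≤ ‖z + (a : ℂ)‖ := by
  have := Complex.re_le_norm (z + (a : ℂ))
  simp at this
  linarith

theorem aux_zero (z : ℂ) (hz : 0 ≤ z.re) (a : ℝ) (ha : 0 < a) (x : ℂ)
    (h : (z + (a : ℂ)) * x = 0) : x = 0 :=
  (mul_eq_zero.mp h).resolve_left (aux_ne z hz a ha)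

theorem aux_bound (z : ℂ) (hz : 0 ≤ z.re) (a b : ℝ) (hb : 0 ≤ b) (x y : ℂ)
    (h : (z + (a : ℂ)) * x = (b : ℂ) * y) : a * ‖x‖ ≤ b * ‖y‖ := by
  have h1 := congrArg norm h
  rw [norm_mul, norm_mul, Complex.norm_real, Real.norm_of_nonneg hb] at h1
  have := mul_le_mul_of_nonneg_right (aux_norm z hz a) (norm_nonneg x)
  linarith

/-- Local asymptotic stability of the disease-free equilibrium: if `R0 < 1`, every
complex eigenvalue of the Jacobian `J` at the DFE has negative real part. -/
theorem stmt_6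
    (μ β1 σ γ1 γ2 γ3 τ δ l ω ρ κ : ℝ)
    (hμ : 0 < μ) (hβ1 : 0 < β1) (hσ : 0 < σ)
    (hγ1 : 0 < γ1) (hγ2 : 0 < γ2) (hγ3 : 0 < γ3) (hτ : 0 < τ) (hδ : 0 < δ)
    (hl : 0 < l) (hω : 0 < ω)
    (hρ0 : 0 ≤ ρ) (hρ1 : ρ ≤ 1) (hκ0 : 0 < κ) (hκ1 : κ < 1)
    (J : Matrix (Fin 7) (Fin 7) ℝ)
    (hJ : J = !![-(μ + l), ω, 0, -(ρ * β1), -β1, 0, 0;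
                 l, -(μ + ω), 0, 0, 0, 0, 0;
                 0, 0, -(μ + σ), ρ * β1, β1, 0, 0;
                 0, 0, (1 - κ) * σ, -(μ + γ1), 0, 0, 0;
                 0, 0, κ * σ, 0, -(μ + γ2 + τ), 0, 0;
                 0, 0, 0, 0, τ, -(μ + γ3 + δ), 0;
                 0, 0, 0, γ1, γ2, γ3, -μ])
    (hR0 : β1 * κ * σ / ((μ + σ) * (γ2 + τ + μ))
        + ρ * β1 * (1 - κ) * σ / ((μ + σ) * (γ1 + μ)) < 1) :
    ∀ z ∈ spectrum ℂ (J.map (algebraMap ℝ ℂ)), z.re < 0 := by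
  intro z hz
  by_contra hcon
  have hre : 0 ≤ z.re := not_lt.mp hcon
  rw [spectrum.mem_iff, Matrix.isUnit_iff_isUnit_det, isUnit_iff_ne_zero, not_not] at hz
  obtain ⟨v, hv0, hv⟩ := Matrix.exists_mulVec_eq_zero_iff.mpr hz
  rw [Matrix.sub_mulVec, Algebra.algebraMap_eq_smul_one, Matrix.smul_mulVec,
    Matrix.one_mulVec, hJ] at hv
  have e0 := congrFun hv 0
  have e1 := congrFun hv 1
  have e2 := congrFun hv 2
  have e3 := congrFun hv 3
  have e4 := congrFun hv 4
  have e5 := congrFun hv 5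
  have e6 := congrFun hv 6
  simp [Matrix.mulVec, dotProduct, Fin.sum_univ_succ] at e0 e1 e2 e3 e4 e5 e6
  have b3 := aux_bound z hre (μ + γ1) ((1 - κ) * σ) (mul_nonneg (by linarith) hσ.le) (v 3) (v 2)
    (by push_cast; linear_combination e3)
  have b4 := aux_bound z hre (μ + γ2 + τ) (κ * σ) (by positivity) (v 4) (v 2)
    (by push_cast; linear_combination e4)
  have b2 := aux_bound z hre (μ + σ) β1 hβ1.le (v 2) (ρ * v 3 + v 4)
    (by push_cast; linear_combination e2)
  have b2' : ‖(ρ : ℂ) * v 3 + v 4‖ ≤ ρ * ‖v 3‖ + ‖v 4‖ := by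
    refine (norm_add_le _ _).trans ?_
    rw [norm_mul, Complex.norm_real, Real.norm_of_nonneg hρ0]
  have hv2 : v 2 = 0 := by
    by_contra hne
    have hp : 0 < ‖v 2‖ := norm_pos_iff.mpr hne
    have c3 : ‖v 3‖ ≤ (1 - κ) * σ * ‖v 2‖ / (γ1 + μ) := by
      rw [le_div_iff₀ (by positivity)]; linarith
    have c4 : ‖v 4‖ ≤ κ * σ * ‖v 2‖ / (γ2 + τ + μ) := by
      rw [le_div_iff₀ (by positivity)]; linarith
    have c : (μ + σ) * ‖v 2‖ ≤ β1 * (ρ * ((1 - κ) * σ * ‖v 2‖ / (γ1 + μ))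
        + κ * σ * ‖v 2‖ / (γ2 + τ + μ)) := by
      refine b2.trans (mul_le_mul_of_nonneg_left (b2'.trans ?_) hβ1.le)
      exact add_le_add (mul_le_mul_of_nonneg_left c3 hρ0) c4
    have d := mul_lt_mul_of_pos_right hR0 (show 0 < (μ + σ) * ‖v 2‖ by positivity)
    have e : (β1 * κ * σ / ((μ + σ) * (γ2 + τ + μ))
        + ρ * β1 * (1 - κ) * σ / ((μ + σ) * (γ1 + μ))) * ((μ + σ) * ‖v 2‖)
        = β1 * (ρ * ((1 - κ) * σ * ‖v 2‖ / (γ1 + μ)) + κ * σ * ‖v 2‖ / (γ2 + τ + μ)) := by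
      have : μ + σ ≠ 0 := by positivity
      have : γ1 + μ ≠ 0 := by positivity
      have : γ2 + τ + μ ≠ 0 := by positivity
      field_simp
      ring
    linarith
  rw [hv2] at e2 e3 e4
  have hv3 : v 3 = 0 := aux_zero z hre (μ + γ1) (by positivity) _
    (by push_cast; linear_combination e3)
  have hv4 : v 4 = 0 := aux_zero z hre (μ + γ2 + τ) (by positivity) _
    (by push_cast; linear_combination e4)
  rw [hv4] at e5
  have hv5 : v 5 = 0 := aux_zero z hre (μ + γ3 + δ) (by positivity) _
    (by push_cast; linear_combination e5)
  rw [hv3, hv4, hv5] at e6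
  have hv6 : v 6 = 0 := aux_zero z hre μ hμ _ (by linear_combination e6)
  rw [hv3, hv4] at e0
  have hs : v 0 + v 1 = 0 := aux_zero z hre μ hμ _ (by linear_combination e0 + e1)
  have hv0' : v 0 = 0 := aux_zero z hre (μ + l + ω) (by positivity) _
    (by push_cast; linear_combination e0 + ω * hs)
  have hv1 : v 1 = 0 := by linear_combination hs - hv0'
  apply hv0
  ext i
  fin_cases i <;> simp [*]
end

section
/- Let J be the 7×7 real matrix with rows: (−(μ+l), ω, 0, −ρβ1, −β1, 0, 0), (l, −(μ+ω), 0, 0, 0, 0, 0), (0, 0, −(μ+σ), ρβ1, β1, 0, 0), (0, 0, (1−κ)σ, −(μ+γ1), 0, 0, 0), (0, 0, κσ, 0, −(μ+γ2+τ), 0, 0), (0, 0, 0, 0, τ, −(μ+γ3+δ), 0), (0, 0, 0, γ1, γ2, γ3, −μ). If R0 > 1, then J has a complex eigenvalue with positive real part (so the disease-free equilibrium of the model with lockdown is unstable). -/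
/-- Instability of the disease-free equilibrium: if `R0 > 1`, the Jacobian `J` at the
DFE has a complex eigenvalue with positive real part. -/
theorem stmt_7
    (μ β1 σ γ1 γ2 γ3 τ δ l ω ρ κ : ℝ)
    (hμ : 0 < μ) (hβ1 : 0 < β1) (hσ : 0 < σ)
    (hγ1 : 0 < γ1) (hγ2 : 0 < γ2) (hγ3 : 0 < γ3) (hτ : 0 < τ) (hδ : 0 < δ)
    (hl : 0 < l) (hω : 0 < ω)
    (hρ0 : 0 ≤ ρ) (hρ1 : ρ ≤ 1) (hκ0 : 0 < κ) (hκ1 : κ < 1)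
    (J : Matrix (Fin 7) (Fin 7) ℝ)
    (hJ : J = !![-(μ + l), ω, 0, -(ρ * β1), -β1, 0, 0;
                 l, -(μ + ω), 0, 0, 0, 0, 0;
                 0, 0, -(μ + σ), ρ * β1, β1, 0, 0;
                 0, 0, (1 - κ) * σ, -(μ + γ1), 0, 0, 0;
                 0, 0, κ * σ, 0, -(μ + γ2 + τ), 0, 0;
                 0, 0, 0, 0, τ, -(μ + γ3 + δ), 0;
                 0, 0, 0, γ1, γ2, γ3, -μ])
    (hR0 : 1 < β1 * κ * σ / ((μ + σ) * (γ2 + τ + μ))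
        + ρ * β1 * (1 - κ) * σ / ((μ + σ) * (γ1 + μ))) :
    ∃ z ∈ spectrum ℂ (J.map (algebraMap ℝ ℂ)), 0 < z.re := by
  have ha : 0 < μ + σ := by positivity
  have hb : 0 < μ + γ1 := by positivity
  have hc : 0 < μ + γ2 + τ := by positivity
  have hk : 0 < 1 - κ := by linarith
  obtain ⟨x, hx, hfx⟩ : ∃ x : ℝ, 0 < x ∧ (x + (μ + σ)) * (x + (μ + γ1)) * (x + (μ + γ2 + τ))
      - ρ * β1 * ((1 - κ) * σ) * (x + (μ + γ2 + τ)) - β1 * (κ * σ) * (x + (μ + γ1)) = 0 := by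
    have h0 : (μ + σ) * (μ + γ1) * (μ + γ2 + τ)
      - ρ * β1 * ((1 - κ) * σ) * (μ + γ2 + τ) - β1 * (κ * σ) * (μ + γ1) < 0 := by
      have e : β1 * κ * σ / ((μ + σ) * (γ2 + τ + μ))
        + ρ * β1 * (1 - κ) * σ / ((μ + σ) * (γ1 + μ)) =
        (ρ * β1 * ((1 - κ) * σ) * (μ + γ2 + τ) + β1 * (κ * σ) * (μ + γ1)) /
          ((μ + σ) * (μ + γ1) * (μ + γ2 + τ)) := by
        rw [show γ2 + τ + μ = μ + γ2 + τ by ring, show γ1 + μ = μ + γ1 by ring]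
        field_simp
        ring
      rw [e, one_lt_div (by positivity)] at hR0
      linarith
    have hA : 0 ≤ ρ * β1 * ((1 - κ) * σ) := by positivity
    have hB : 0 < β1 * (κ * σ) := by positivity
    generalize ρ * β1 * ((1 - κ) * σ) = A at *
    generalize β1 * (κ * σ) = B at *
    generalize μ + σ = a at *
    generalize μ + γ1 = b at *
    generalize μ + γ2 + τ = c at *
    obtain ⟨p, rfl⟩ : ∃ p, A = p * b := ⟨A / b, by field_simp⟩
    obtain ⟨q, rfl⟩ : ∃ q, B = q * c := ⟨B / c, by field_simp⟩
    have hp : 0 ≤ p := nonneg_of_mul_nonneg_left hA hb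
    have hq : 0 < q := pos_of_mul_pos_left hB hc.le
    have hcont : ContinuousOn (fun x : ℝ => (x + a) * (x + b) * (x + c)
      - p * b * (x + c) - q * c * (x + b)) (Set.Icc 0 (p + q)) := by fun_prop
    have h1 : 0 ≤ (p + q + a) * (p + q + b) * (p + q + c)
      - p * b * (p + q + c) - q * c * (p + q + b) := by
      have : (p + q + a) * (p + q + b) * (p + q + c)
        - p * b * (p + q + c) - q * c * (p + q + b) = a * (p + q + b) * (p + q + c)
          + p * (p + q) * (p + q + c) + q * (p + q) * (p + q + b) := by ring
      rw [this]
      positivity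
    obtain ⟨x, hx, hxe⟩ := intermediate_value_Icc (by positivity) hcont
      (show (0 : ℝ) ∈ _ from ⟨by simpa using h0.le, h1⟩)
    refine ⟨x, lt_of_le_of_ne hx.1 ?_, hxe⟩
    rintro rfl
    simp only [zero_add] at hxe
    linarith
  refine ⟨(x : ℂ), ?_, by simpa using hx⟩
  rw [spectrum.mem_iff, Matrix.isUnit_iff_isUnit_det, isUnit_iff_ne_zero, not_not,
    ← Matrix.exists_vecMul_eq_zero_iff]
  have hfx' : ((x:ℂ) + (μ + σ)) * (x + (μ + γ1)) * (x + (μ + γ2 + τ))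
      - ρ * β1 * ((1 - κ) * σ) * (x + (μ + γ2 + τ)) - β1 * (κ * σ) * (x + (μ + γ1)) = 0 := by
    exact_mod_cast congrArg (fun r : ℝ => (r : ℂ)) hfx
  refine ⟨![0, 0, ((x + (μ + γ1)) * (x + (μ + γ2 + τ)) : ℝ),
    (ρ * β1 * (x + (μ + γ2 + τ)) : ℝ), (β1 * (x + (μ + γ1)) : ℝ), 0, 0], ?_, ?_⟩
  · intro h
    have h2 := congrFun h 4
    have : β1 * (x + (μ + γ1)) ≠ 0 := by positivity
    apply this
    have h3 : ((β1 * (x + (μ + γ1)) : ℝ) : ℂ) = 0 := h2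
    exact_mod_cast h3
  · subst hJ
    rw [Matrix.vecMul_sub, Algebra.algebraMap_eq_smul_one, Matrix.vecMul_smul, Matrix.vecMul_one,
      sub_eq_zero]
    funext j
    fin_cases j <;>
      simp [Matrix.vecMul, dotProduct, Fin.sum_univ_succ] <;>
      first | ring1 | linear_combination hfx'
end

section
/- Set k1 = μ+σ, k2 = γ1+μ, k3 = γ2+τ+μ, and define the Lyapunov function 𝓛 = (σ(κ k2 + ρ(1−κ)k3)/(k1 k2))·E + (ρ k3/k2)·A + I. Let (S,L,E,A,I,C,R) be a differentiable solution of the COVID-19 model with lockdown on [0,∞) with all components nonnegative and with 0 < S(t) ≤ N(t) − L(t) − C(t) for all t ≥ 0. Then for every t ≥ 0, the derivative of t ↦ 𝓛(t) satisfies 𝓛'(t) ≤ k3 (R0 − 1)(I(t) + ρ A(t)); in particular 𝓛'(t) ≤ 0 whenever R0 ≤ 1. -/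
/-- Lyapunov derivative estimate: along nonnegative solutions of the model with lockdown
with `0 < S ≤ N - L - C`, the derivative of `𝓛 = c₁E + c₂A + I` satisfies
`𝓛' ≤ k₃(R0-1)(I + ρA)`; in particular `𝓛' ≤ 0` whenever `R0 ≤ 1`. -/
theorem stmt_8
    (PiH μ β1 σ γ1 γ2 γ3 τ δ l ω ρ κ : ℝ)
    (hPiH : 0 < PiH) (hμ : 0 < μ) (hβ1 : 0 < β1) (hσ : 0 < σ)
    (hγ1 : 0 < γ1) (hγ2 : 0 < γ2) (hγ3 : 0 < γ3) (hτ : 0 < τ)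
    (hδ : 0 < δ) (hl : 0 < l) (hω : 0 < ω)
    (hρ0 : 0 ≤ ρ) (hρ1 : ρ ≤ 1) (hκ0 : 0 < κ) (hκ1 : κ < 1)
    (k1 k2 k3 R0 : ℝ)
    (hk1 : k1 = μ + σ) (hk2 : k2 = γ1 + μ) (hk3 : k3 = γ2 + τ + μ)
    (hR0 : R0 = β1 * κ * σ / ((μ + σ) * (γ2 + τ + μ))
        + ρ * β1 * (1 - κ) * σ / ((μ + σ) * (γ1 + μ)))
    (S L E A I C R N : ℝ → ℝ)
    (hN : ∀ t, N t = S t + L t + E t + A t + I t + C t + R t)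
    (hnonneg : ∀ t ≥ (0:ℝ), 0 ≤ S t ∧ 0 ≤ L t ∧ 0 ≤ E t ∧ 0 ≤ A t ∧ 0 ≤ I t ∧ 0 ≤ C t ∧ 0 ≤ R t)
    (hSpos : ∀ t ≥ (0:ℝ), 0 < S t)
    (hSle : ∀ t ≥ (0:ℝ), S t ≤ N t - L t - C t)
    (hS : ∀ t ≥ (0:ℝ), HasDerivAt S (PiH + ω * L t
      - β1 * I t * S t / (N t - L t - C t)
      - ρ * β1 * A t * S t / (N t - L t - C t) - μ * S t - l * S t) t)
    (hL : ∀ t ≥ (0:ℝ), HasDerivAt L (l * S t - (μ + ω) * L t) t)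
    (hE : ∀ t ≥ (0:ℝ), HasDerivAt E (β1 * I t * S t / (N t - L t - C t)
      + ρ * β1 * A t * S t / (N t - L t - C t) - (μ + σ) * E t) t)
    (hA : ∀ t ≥ (0:ℝ), HasDerivAt A ((1 - κ) * σ * E t - (γ1 + μ) * A t) t)
    (hI : ∀ t ≥ (0:ℝ), HasDerivAt I (κ * σ * E t - (γ2 + τ + μ) * I t) t)
    (hC : ∀ t ≥ (0:ℝ), HasDerivAt C (τ * I t - (δ + γ3 + μ) * C t) t)
    (hR : ∀ t ≥ (0:ℝ), HasDerivAt R (γ1 * A t + γ2 * I t + γ3 * C t - μ * R t) t) :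
    ∀ t ≥ (0:ℝ), ∃ d : ℝ,
      HasDerivAt (fun s => σ * (κ * k2 + ρ * (1 - κ) * k3) / (k1 * k2) * E s
        + ρ * k3 / k2 * A s + I s) d t ∧
      d ≤ k3 * (R0 - 1) * (I t + ρ * A t) ∧
      (R0 ≤ 1 → d ≤ 0) := by
  intro t ht
  obtain ⟨-, -, -, hA0, hI0, -, -⟩ := hnonneg t ht
  have hp1 : 0 < k1 := by rw [hk1]; positivity
  have hp2 : 0 < k2 := by rw [hk2]; positivity
  have hp3 : 0 < k3 := by rw [hk3]; positivity
  have hD : 0 < N t - L t - C t := lt_of_lt_of_le (hSpos t ht) (hSle t ht)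
  have hq : S t / (N t - L t - C t) ≤ 1 := (div_le_one hD).2 (hSle t ht)
  have hE' := hE t ht
  have hA' := hA t ht
  have hI' := hI t ht
  rw [← hk1] at hE' hR0
  rw [← hk2] at hA' hR0
  rw [← hk3] at hI' hR0
  have hder := ((hE'.const_mul (σ * (κ * k2 + ρ * (1 - κ) * k3) / (k1 * k2))).add
    (hA'.const_mul (ρ * k3 / k2))).add hI'
  have hR0nn : 0 ≤ R0 := by
    have : 0 < 1 - κ := by linarith
    rw [hR0]; positivity
  have hX : 0 ≤ I t + ρ * A t := by positivity
  have key : σ * (κ * k2 + ρ * (1 - κ) * k3) / (k1 * k2) *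
        (β1 * I t * S t / (N t - L t - C t) + ρ * β1 * A t * S t / (N t - L t - C t) - k1 * E t)
      + ρ * k3 / k2 * ((1 - κ) * σ * E t - k2 * A t) + (κ * σ * E t - k3 * I t)
      = k3 * R0 * (I t + ρ * A t) * (S t / (N t - L t - C t)) - k3 * (I t + ρ * A t) := by
    rw [hR0]
    generalize N t - L t - C t = D at hD
    field_simp
    ring
  have hle : k3 * R0 * (I t + ρ * A t) * (S t / (N t - L t - C t)) ≤ k3 * R0 * (I t + ρ * A t) :=
    mul_le_of_le_one_right (by positivity) hq
  have hb : σ * (κ * k2 + ρ * (1 - κ) * k3) / (k1 * k2) *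
        (β1 * I t * S t / (N t - L t - C t) + ρ * β1 * A t * S t / (N t - L t - C t) - k1 * E t)
      + ρ * k3 / k2 * ((1 - κ) * σ * E t - k2 * A t) + (κ * σ * E t - k3 * I t)
      ≤ k3 * (R0 - 1) * (I t + ρ * A t) := by
    rw [key]; linarith
  refine ⟨_, hder, hb, fun h => hb.trans ?_⟩
  exact mul_nonpos_of_nonpos_of_nonneg
    (mul_nonpos_of_nonneg_of_nonpos hp3.le (by linarith)) hX
end

section
/- Suppose R0 ≤ 1. Let (S,L,E,A,I,C,R) be a differentiable solution of the COVID-19 model with lockdown on [0,∞) with all components nonnegative, with 0 < S(t) ≤ N(t) − L(t) − C(t) for all t ≥ 0, and with N(t) = S+L+E+A+I+C+R ≤ ΠH/μ for all t ≥ 0. Then as t → ∞ the solution converges to the disease-free equilibrium: S(t) → ΠH(μ+ω)/(μ(μ+ω+l)), L(t) → ΠH·l/(μ(μ+ω+l)), and E(t), A(t), I(t), C(t), R(t) → 0. That is, the disease-free equilibrium is globally asymptotically stable in Ω whenever R0 ≤ 1. -/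
lemma anti_aux (f f' : ℝ → ℝ) (a b : ℝ) (hab : a ≤ b)
    (hf : ∀ t ≥ a, HasDerivAt f (f' t) t) (hn : ∀ t, a ≤ t → t ≤ b → f' t ≤ 0) : f b ≤ f a := by
  have : AntitoneOn f (Set.Icc a b) := by
    apply antitoneOn_of_hasDerivWithinAt_nonpos (f' := f') (convex_Icc a b)
    · intro t ht
      exact (hf t ht.1).continuousAt.continuousWithinAt
    · intro t ht
      rw [interior_Icc] at ht
      exact (hf t ht.1.le).hasDerivWithinAt
    · intro t ht
      rw [interior_Icc] at ht
      exact hn t ht.1.le ht.2.le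
  exact this (Set.left_mem_Icc.2 hab) (Set.right_mem_Icc.2 hab) hab

lemma upper_aux (x u : ℝ → ℝ) (k v : ℝ) (hk : 0 < k)
    (hx : ∀ t ≥ (0:ℝ), HasDerivAt x (u t - k * x t) t)
    (hu : Filter.Tendsto u Filter.atTop (nhds v)) (ε : ℝ) (hε : 0 < ε) :
    ∀ᶠ t in Filter.atTop, x t < v / k + ε := by
  have h1 : ∀ᶠ t in Filter.atTop, u t < v + k * ε / 2 :=
    hu.eventually_lt_const (by have := mul_pos hk hε; linarith)
  obtain ⟨T, hT⟩ := Filter.eventually_atTop.1 (h1.and (Filter.eventually_ge_atTop (0:ℝ)))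
  have hT0 : 0 ≤ T := (hT T le_rfl).2
  set w := v / k + ε / 2 with hw
  have hkw : k * w = v + k * ε / 2 := by rw [hw]; field_simp
  have h2 : ∀ t ≥ T, (x t - w) * Real.exp (k * t) ≤ (x T - w) * Real.exp (k * T) := by
    intro t ht
    refine anti_aux (fun t => (x t - w) * Real.exp (k * t))
      (fun t => (u t - k * w) * Real.exp (k * t)) T t ht ?_ ?_
    · intro s hs
      have e1 : HasDerivAt (fun t => Real.exp (k * t)) (Real.exp (k * s) * (k * 1)) s :=
        ((hasDerivAt_id' s).const_mul k).exp
      refine (((hx s (hT0.trans hs)).sub_const w).mul e1).congr_deriv ?_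
      ring
    · intro s hs _
      have := (hT s hs).1
      exact mul_nonpos_of_nonpos_of_nonneg (by linarith) (Real.exp_pos _).le
  have h3 : Filter.Tendsto (fun t => (x T - w) * Real.exp (k * T) * Real.exp (-(k * t)))
      Filter.atTop (nhds ((x T - w) * Real.exp (k * T) * 0)) := by
    apply Filter.Tendsto.const_mul
    apply Real.tendsto_exp_neg_atTop_nhds_zero.comp
    exact Filter.tendsto_id.const_mul_atTop hk
  rw [mul_zero] at h3
  filter_upwards [h3.eventually_lt_const (half_pos hε), Filter.eventually_ge_atTop T] with t ht htT
  have h4 := mul_le_mul_of_nonneg_right (h2 t htT) (Real.exp_pos (-(k * t))).le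
  rw [mul_assoc (x t - w), ← Real.exp_add, add_neg_cancel, Real.exp_zero, mul_one] at h4
  linarith

lemma lin_aux (x u : ℝ → ℝ) (k v : ℝ) (hk : 0 < k)
    (hx : ∀ t ≥ (0:ℝ), HasDerivAt x (u t - k * x t) t)
    (hu : Filter.Tendsto u Filter.atTop (nhds v)) :
    Filter.Tendsto x Filter.atTop (nhds (v / k)) := by
  rw [tendsto_order]
  constructor
  · intro a ha
    have := upper_aux (fun t => - x t) (fun t => - u t) k (-v) hk
      (fun t ht => (hx t ht).neg.congr_deriv (by ring)) hu.neg (v / k - a) (by linarith)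
    filter_upwards [this] with t ht
    rw [neg_div] at ht
    linarith
  · intro a ha
    have := upper_aux x u k v hk hx hu (a - v / k) (by linarith)
    filter_upwards [this] with t ht
    linarith

lemma barb_aux (W W' f f' : ℝ → ℝ) (a c B : ℝ) (ha : 0 < a) (hc : 0 < c)
    (hW : ∀ t ≥ (0:ℝ), HasDerivAt W (W' t) t) (hf : ∀ t ≥ (0:ℝ), HasDerivAt f (f' t) t)
    (hB : ∀ t ≥ (0:ℝ), B ≤ W t) (hf0 : ∀ t ≥ (0:ℝ), 0 ≤ f t)
    (hf' : ∀ t ≥ (0:ℝ), -a * f t ≤ f' t)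
    (hW' : ∀ t ≥ (0:ℝ), W' t ≤ -c * f t ^ 2) :
    Filter.Tendsto f Filter.atTop (nhds 0) := by
  have hanti : ∀ s t, 0 ≤ s → s ≤ t → W t ≤ W s := by
    intro s t hs hst
    refine anti_aux W W' s t hst (fun r hr => hW r (hs.trans hr)) ?_
    intro r hr _
    have := hW' r (hs.trans hr)
    nlinarith [mul_nonneg hc.le (sq_nonneg (f r))]
  -- decay bound
  have hdec : ∀ s t, 0 ≤ s → s ≤ t → t ≤ s + 1 → f s * Real.exp (-a) ≤ f t := by
    intro s t hs hst ht1
    have h := anti_aux (fun t => -(f t * Real.exp (a * t)))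
      (fun t => -((f' t + a * f t) * Real.exp (a * t))) s t hst ?_ ?_
    · have h : f s * Real.exp (a * s) ≤ f t * Real.exp (a * t) := by linarith
      have h4 := mul_le_mul_of_nonneg_right h (Real.exp_pos (-(a * t))).le
      rw [mul_assoc, mul_assoc, ← Real.exp_add, ← Real.exp_add, add_neg_cancel, Real.exp_zero,
        mul_one] at h4
      refine le_trans (mul_le_mul_of_nonneg_left (Real.exp_le_exp.2 ?_) (hf0 s hs)) h4
      nlinarith
    · intro r hr
      have e1 : HasDerivAt (fun t => Real.exp (a * t)) (Real.exp (a * r) * (a * 1)) r :=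
        ((hasDerivAt_id' r).const_mul a).exp
      refine ((hf r (hs.trans hr)).mul e1).neg.congr_deriv ?_
      ring
    · intro r hr _
      have := hf' r (hs.trans hr)
      have := mul_nonneg (show 0 ≤ f' r + a * f r by linarith) (Real.exp_pos (a * r)).le
      linarith
  set d := c * Real.exp (-a) ^ 2 with hd
  have hdpos : 0 < d := by positivity
  have hdrop : ∀ t ≥ (0:ℝ), d * f t ^ 2 ≤ W t - W (t + 1) := by
    intro t ht
    have h := anti_aux (fun s => W s + d * f t ^ 2 * s) (fun s => W' s + d * f t ^ 2) t (t + 1)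
      (by linarith) ?_ ?_
    · linarith
    · intro r hr
      refine ((hW r (ht.le.trans hr)).add
        ((hasDerivAt_id' r).const_mul (d * f t ^ 2))).congr_deriv ?_
      ring
    · intro r hr hr1
      have h1 := hW' r (ht.le.trans hr)
      have h2 := hdec t r ht hr hr1
      have h3 : (f t * Real.exp (-a)) ^ 2 ≤ f r ^ 2 :=
        pow_le_pow_left₀ (mul_nonneg (hf0 t ht) (Real.exp_pos _).le) h2 2
      have h4 := mul_le_mul_of_nonneg_left h3 hc.le
      rw [hd]
      nlinarith
  -- W converges
  have hlim : ∃ w, Filter.Tendsto W Filter.atTop (nhds w) := by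
    have hA : Antitone (fun t => W (max t 0)) := fun s t hst =>
      hanti _ _ (le_max_right _ _) (max_le_max_right 0 hst)
    have hb : BddBelow (Set.range (fun t => W (max t 0))) :=
      ⟨B, by rintro _ ⟨t, rfl⟩; exact hB _ (le_max_right _ _)⟩
    refine ⟨_, (tendsto_atTop_ciInf hA hb).congr' ?_⟩
    filter_upwards [Filter.eventually_ge_atTop (0:ℝ)] with t ht
    rw [max_eq_left ht]
  obtain ⟨w, hw⟩ := hlim
  have hw1 : Filter.Tendsto (fun t => W (t + 1)) Filter.atTop (nhds w) :=
    hw.comp (Filter.tendsto_atTop_add_const_right _ 1 Filter.tendsto_id)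
  have hdiff : Filter.Tendsto (fun t => Real.sqrt ((W t - W (t + 1)) / d)) Filter.atTop (nhds 0) := by
    have := ((hw.sub hw1).div_const d).sqrt
    simpa using this
  refine tendsto_of_tendsto_of_tendsto_of_le_of_le' tendsto_const_nhds hdiff ?_ ?_
  · filter_upwards [Filter.eventually_ge_atTop (0:ℝ)] with t ht using hf0 t ht
  · filter_upwards [Filter.eventually_ge_atTop (0:ℝ)] with t ht
    apply Real.le_sqrt_of_sq_le
    rw [le_div_iff₀ hdpos]
    linarith [hdrop t ht]

/-- Global asymptotic stability of the disease-free equilibrium for `R0 ≤ 1`: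
every nonnegative solution in `Ω` converges to the disease-free equilibrium. -/
theorem stmt_12
    (PiH μ β1 σ γ1 γ2 γ3 τ δ l ω ρ κ : ℝ)
    (hPiH : 0 < PiH) (hμ : 0 < μ) (hβ1 : 0 < β1) (hσ : 0 < σ)
    (hγ1 : 0 < γ1) (hγ2 : 0 < γ2) (hγ3 : 0 < γ3) (hτ : 0 < τ)
    (hδ : 0 < δ) (hl : 0 < l) (hω : 0 < ω)
    (hρ0 : 0 ≤ ρ) (hρ1 : ρ ≤ 1) (hκ0 : 0 < κ) (hκ1 : κ < 1)
    (hR0le : β1 * κ * σ / ((μ + σ) * (γ2 + τ + μ))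
        + ρ * β1 * (1 - κ) * σ / ((μ + σ) * (γ1 + μ)) ≤ 1)
    (S L E A I C R N : ℝ → ℝ)
    (hN : ∀ t, N t = S t + L t + E t + A t + I t + C t + R t)
    (hnonneg : ∀ t ≥ (0:ℝ), 0 ≤ S t ∧ 0 ≤ L t ∧ 0 ≤ E t ∧ 0 ≤ A t ∧ 0 ≤ I t ∧ 0 ≤ C t ∧ 0 ≤ R t)
    (hSpos : ∀ t ≥ (0:ℝ), 0 < S t)
    (hSle : ∀ t ≥ (0:ℝ), S t ≤ N t - L t - C t)
    (hNle : ∀ t ≥ (0:ℝ), N t ≤ PiH / μ)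
    (hS : ∀ t ≥ (0:ℝ), HasDerivAt S (PiH + ω * L t
      - β1 * I t * S t / (N t - L t - C t)
      - ρ * β1 * A t * S t / (N t - L t - C t) - μ * S t - l * S t) t)
    (hL : ∀ t ≥ (0:ℝ), HasDerivAt L (l * S t - (μ + ω) * L t) t)
    (hE : ∀ t ≥ (0:ℝ), HasDerivAt E (β1 * I t * S t / (N t - L t - C t)
      + ρ * β1 * A t * S t / (N t - L t - C t) - (μ + σ) * E t) t)
    (hA : ∀ t ≥ (0:ℝ), HasDerivAt A ((1 - κ) * σ * E t - (γ1 + μ) * A t) t)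
    (hI : ∀ t ≥ (0:ℝ), HasDerivAt I (κ * σ * E t - (γ2 + τ + μ) * I t) t)
    (hC : ∀ t ≥ (0:ℝ), HasDerivAt C (τ * I t - (δ + γ3 + μ) * C t) t)
    (hR : ∀ t ≥ (0:ℝ), HasDerivAt R (γ1 * A t + γ2 * I t + γ3 * C t - μ * R t) t) :
    Filter.Tendsto S Filter.atTop (nhds (PiH * (μ + ω) / (μ * (μ + ω + l)))) ∧
    Filter.Tendsto L Filter.atTop (nhds (PiH * l / (μ * (μ + ω + l)))) ∧
    Filter.Tendsto E Filter.atTop (nhds 0) ∧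
    Filter.Tendsto A Filter.atTop (nhds 0) ∧
    Filter.Tendsto I Filter.atTop (nhds 0) ∧
    Filter.Tendsto C Filter.atTop (nhds 0) ∧
    Filter.Tendsto R Filter.atTop (nhds 0) := by
  have hP : 0 < PiH / μ := div_pos hPiH hμ
  set P := PiH / μ with hPdef
  have hk2 : 0 < γ2 + τ + μ := by positivity
  have hk1 : 0 < γ1 + μ := by positivity
  have hk0 : 0 < μ + σ := by positivity
  obtain ⟨k2, hk2e⟩ : ∃ k, k = γ2 + τ + μ := ⟨_, rfl⟩
  obtain ⟨k1, hk1e⟩ : ∃ k, k = γ1 + μ := ⟨_, rfl⟩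
  obtain ⟨k0, hk0e⟩ : ∃ k, k = μ + σ := ⟨_, rfl⟩
  rw [← hk2e] at hk2 hR0le
  rw [← hk1e] at hk1 hR0le
  rw [← hk0e] at hk0 hR0le
  simp only [← hk2e] at hI
  simp only [← hk1e] at hA
  simp only [← hk0e] at hE
  have hR0 : β1 / k2 * (κ * σ) + ρ * β1 / k1 * ((1 - κ) * σ) ≤ k0 := by
    have h := mul_le_mul_of_nonneg_right hR0le hk0.le
    have e : (β1 * κ * σ / (k0 * k2) + ρ * β1 * (1 - κ) * σ / (k0 * k1)) * k0
      = β1 / k2 * (κ * σ) + ρ * β1 / k1 * ((1 - κ) * σ) := by field_simp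
    linarith
  obtain ⟨b, hb⟩ : ∃ b, b = β1 / k2 := ⟨_, rfl⟩
  obtain ⟨a, ha⟩ : ∃ a, a = ρ * β1 / k1 := ⟨_, rfl⟩
  rw [← hb, ← ha] at hR0
  have hbk : b * k2 = β1 := by rw [hb]; field_simp
  have hak : a * k1 = ρ * β1 := by rw [ha]; field_simp
  have hb0 : 0 ≤ b := by rw [hb]; positivity
  have ha0 : 0 ≤ a := by rw [ha]; positivity
  obtain ⟨c, hc⟩ : ∃ c, c = β1 / P := ⟨_, rfl⟩
  have hc0 : 0 < c := by rw [hc]; positivity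
  obtain ⟨ε, hε⟩ : ∃ ε, ε = c / (k2 + k0) := ⟨_, rfl⟩
  have hε0 : 0 < ε := by rw [hε]; positivity
  have hεk : ε * (k2 + k0) = c := by rw [hε]; field_simp
  have hEt : Filter.Tendsto E Filter.atTop (nhds 0) := by
    refine barb_aux (fun t => E t + a * A t + b * I t - ε * (I t * E t)) _ E _ k0 (ε * (κ * σ))
      (-(ε * (P * P))) hk0 (by positivity)
      (fun t ht => (((hE t ht).add ((hA t ht).const_mul a)).add ((hI t ht).const_mul b)).sub
        (((hI t ht).mul (hE t ht)).const_mul ε)) hE ?_ ?_ ?_ ?_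
    · intro t ht
      obtain ⟨h1, h2, h3, h4, h5, h6, h7⟩ := hnonneg t ht
      have hn := hNle t ht
      rw [hN t] at hn
      have : I t * E t ≤ P * P := mul_le_mul (by linarith) (by linarith) h3 hP.le
      have := mul_le_mul_of_nonneg_left this hε0.le
      have := mul_nonneg ha0 h4
      have := mul_nonneg hb0 h5
      show -(ε * (P * P)) ≤ E t + a * A t + b * I t - ε * (I t * E t)
      linarith
    · exact fun t ht => (hnonneg t ht).2.2.1
    · intro t ht
      obtain ⟨h1, h2, h3, h4, h5, h6, h7⟩ := hnonneg t ht
      have hM : 0 < N t - L t - C t := (hSpos t ht).trans_le (hSle t ht)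
      have : 0 ≤ β1 * I t * S t / (N t - L t - C t) := by positivity
      have : 0 ≤ ρ * β1 * A t * S t / (N t - L t - C t) := by positivity
      linarith
    · intro t ht
      obtain ⟨h1, h2, h3, h4, h5, h6, h7⟩ := hnonneg t ht
      have hM : 0 < N t - L t - C t := (hSpos t ht).trans_le (hSle t ht)
      have hMP : N t - L t - C t ≤ P := by linarith [hNle t ht]
      have hSM := hSle t ht
      have hMe : N t - L t - C t - S t = E t + A t + I t + R t := by rw [hN t]; ring
      rw [mul_div_assoc (β1 * I t), mul_div_assoc (ρ * β1 * A t)]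
      generalize N t - L t - C t = M at *
      obtain ⟨q, hq⟩ : ∃ q, q = S t / M := ⟨_, rfl⟩
      have hq0 : 0 ≤ q := by rw [hq]; positivity
      have hq1 : q ≤ 1 := by rw [hq]; exact (div_le_one hM).2 hSM
      have hqE : E t / P ≤ 1 - q := by
        have : 1 - q = (M - S t) / M := by rw [hq]; field_simp
        rw [this, hMe]
        exact div_le_div₀ (by linarith) (by linarith) hM hMP
      rw [← hq]
      have g1 : c * (I t * E t) ≤ β1 * I t * (1 - q) := by
        have := mul_le_mul_of_nonneg_left hqE (mul_nonneg hβ1.le h5)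
        have e : c * (I t * E t) = β1 * I t * (E t / P) := by rw [hc]; ring
        linarith
      have g2 : 0 ≤ ρ * β1 * A t * (1 - q) :=
        mul_nonneg (by positivity) (by linarith)
      have g3 := mul_le_mul_of_nonneg_right hR0 h3
      have g4 : 0 ≤ ε * (I t * (β1 * I t * q + ρ * β1 * A t * q)) := by positivity
      have e1 : b * k2 * I t = β1 * I t := by rw [hbk]
      have e2 : a * k1 * A t = ρ * β1 * A t := by rw [hak]
      have e3 : ε * (k2 + k0) * (I t * E t) = c * (I t * E t) := by rw [hεk]
      linarith
  have hIt : Filter.Tendsto I Filter.atTop (nhds 0) := by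
    have := lin_aux I (fun t => κ * σ * E t) k2 (κ * σ * 0) hk2 hI (hEt.const_mul _)
    simpa using this
  have hAt : Filter.Tendsto A Filter.atTop (nhds 0) := by
    have := lin_aux A (fun t => (1 - κ) * σ * E t) k1 ((1 - κ) * σ * 0) hk1 hA (hEt.const_mul _)
    simpa using this
  have hCt : Filter.Tendsto C Filter.atTop (nhds 0) := by
    have := lin_aux C (fun t => τ * I t) _ (τ * 0) (by positivity) hC (hIt.const_mul _)
    simpa using this
  have hRt : Filter.Tendsto R Filter.atTop (nhds 0) := by
    have := lin_aux R (fun t => γ1 * A t + γ2 * I t + γ3 * C t) _ (γ1 * 0 + γ2 * 0 + γ3 * 0) hμ hR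
      (((hAt.const_mul _).add (hIt.const_mul _)).add (hCt.const_mul _))
    simpa using this
  have hNt : Filter.Tendsto N Filter.atTop (nhds P) := by
    have hNf : S + L + E + A + I + C + R = N := funext fun t => (hN t).symm
    have := lin_aux N (fun t => PiH - δ * C t) μ (PiH - δ * 0) hμ ?_
      (tendsto_const_nhds.sub (hCt.const_mul _))
    · simpa using this
    · intro t ht
      have h := ((((((hS t ht).add (hL t ht)).add (hE t ht)).add (hA t ht)).add (hI t ht)).add
        (hC t ht)).add (hR t ht)
      rw [hNf] at h
      refine h.congr_deriv ?_
      rw [hk2e, hk1e, hk0e]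
      linear_combination μ * hN t
  have hLt : Filter.Tendsto L Filter.atTop (nhds (PiH * l / (μ * (μ + ω + l)))) := by
    have := lin_aux L (fun t => l * (N t - E t - A t - I t - C t - R t)) (μ + ω + l)
      (l * (P - 0 - 0 - 0 - 0 - 0)) (by positivity) ?_
      ((((((hNt.sub hEt).sub hAt).sub hIt).sub hCt).sub hRt).const_mul l)
    · convert this using 2
      rw [hPdef]; field_simp; ring
    · intro t ht
      convert hL t ht using 1
      rw [hN t]; ring
  refine ⟨?_, hLt, hEt, hAt, hIt, hCt, hRt⟩
  have := (((((hNt.sub hLt).sub hEt).sub hAt).sub hIt).sub hCt).sub hRt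
  convert this using 2
  · rw [hN]; ring
  · rw [hPdef]; field_simp; ring
end

section
/- Define M1 = (μ+ω)/(μ+σ), M2 = (1−κ)σ(μ+ω)/((μ+γ1)(μ+σ)), M3 = κσ(μ+ω)/((μ+γ2+τ)(μ+σ)), M4 = κτσ(μ+ω)/((μ+γ2+τ)(μ+γ3+δ)(μ+σ)), A = μM1 + M2(μ+γ1) + M3(μ+γ2) + γ3 M4, and B = μ(μ+ω)(R0 − 1). Let λ* > 0 and suppose the point (S*,L*,E*,A*,I*,C*,R*) given by L* = ΠH·l/(λ*(μ+ω) + μ(μ+ω+l)), S* = (μ+ω)L*/l, E* = M1 L* λ*/l, A* = M2 L* λ*/l, I* = M3 L* λ*/l, C* = M4 L* λ*/l, R* = (γ1 M2 + γ2 M3 + γ3 M4) L* λ*/(l μ) additionally satisfies the force-of-infection relation λ* = β1(I* + ρA*)/(N* − L* − C*) with N* = S*+L*+E*+A*+I*+C*+R*. Then λ* satisfies the linear equation A·λ* = B. -/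
/-- The equilibrium force of infection `λ*` of the model with lockdown satisfies the
linear equation `A·λ* = B`. -/
theorem stmt_13
    (PiH μ β1 σ γ1 γ2 γ3 τ δ l ω ρ κ : ℝ)
    (hPiH : 0 < PiH) (hμ : 0 < μ) (hβ1 : 0 < β1) (hσ : 0 < σ)
    (hγ1 : 0 < γ1) (hγ2 : 0 < γ2) (hγ3 : 0 < γ3) (hτ : 0 < τ)
    (hδ : 0 < δ) (hl : 0 < l) (hω : 0 < ω)
    (hρ0 : 0 ≤ ρ) (hρ1 : ρ ≤ 1) (hκ0 : 0 < κ) (hκ1 : κ < 1)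
    (R0 M1 M2 M3 M4 Acoef Bcoef : ℝ)
    (hR0 : R0 = β1 * κ * σ / ((μ + σ) * (γ2 + τ + μ))
        + ρ * β1 * (1 - κ) * σ / ((μ + σ) * (γ1 + μ)))
    (hM1 : M1 = (μ + ω) / (μ + σ))
    (hM2 : M2 = (1 - κ) * σ * (μ + ω) / ((μ + γ1) * (μ + σ)))
    (hM3 : M3 = κ * σ * (μ + ω) / ((μ + γ2 + τ) * (μ + σ)))
    (hM4 : M4 = κ * τ * σ * (μ + ω) / ((μ + γ2 + τ) * (μ + γ3 + δ) * (μ + σ)))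
    (hAcoef : Acoef = μ * M1 + M2 * (μ + γ1) + M3 * (μ + γ2) + γ3 * M4)
    (hBcoef : Bcoef = μ * (μ + ω) * (R0 - 1))
    (lam Sstar Lstar Estar Astar Istar Cstar Rstar Nstar : ℝ)
    (hlam : 0 < lam)
    (hLs : Lstar = PiH * l / (lam * (μ + ω) + μ * (μ + ω + l)))
    (hSs : Sstar = (μ + ω) * Lstar / l)
    (hEs : Estar = M1 * Lstar * lam / l)
    (hAs : Astar = M2 * Lstar * lam / l)
    (hIs : Istar = M3 * Lstar * lam / l)
    (hCs : Cstar = M4 * Lstar * lam / l)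
    (hRs : Rstar = (γ1 * M2 + γ2 * M3 + γ3 * M4) * Lstar * lam / (l * μ))
    (hNs : Nstar = Sstar + Lstar + Estar + Astar + Istar + Cstar + Rstar)
    (hforce : lam = β1 * (Istar + ρ * Astar) / (Nstar - Lstar - Cstar)) :
    Acoef * lam = Bcoef := by
  have hL : 0 < Lstar := by rw [hLs]; positivity
  have hD : Nstar - Lstar - Cstar ≠ 0 := by
    intro h
    rw [h, div_zero] at hforce
    exact hlam.ne' hforce
  have h1 : lam * (Nstar - Lstar - Cstar) = β1 * (Istar + ρ * Astar) := by
    rw [eq_div_iff hD] at hforce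
    exact hforce
  have h2 : Nstar - Lstar - Cstar
      = Lstar / (l * μ) * (μ * (μ + ω) + Acoef * lam) := by
    rw [hNs, hSs, hEs, hAs, hIs, hCs, hRs, hAcoef]
    field_simp
    ring
  have h3 : β1 * (M3 + ρ * M2) = (μ + ω) * R0 := by
    rw [hM3, hM2, hR0, show γ2 + τ + μ = μ + γ2 + τ by ring, show γ1 + μ = μ + γ1 by ring]
    field_simp
  have h4 : β1 * (Istar + ρ * Astar) = lam * (Lstar / (l * μ)) * (μ * ((μ + ω) * R0)) := by
    rw [← h3, hIs, hAs]
    field_simp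
  rw [h2, h4, ← mul_assoc] at h1
  have h5 : lam * (Lstar / (l * μ)) ≠ 0 := by positivity
  have h6 := mul_left_cancel₀ h5 h1
  rw [hBcoef]
  linarith
end

section
/- Suppose R0 > 1. Define λ* = μ(μ+ω)(R0 − 1)/A where A = μM1 + M2(μ+γ1) + M3(μ+γ2) + γ3 M4 with M1 = (μ+ω)/(μ+σ), M2 = (1−κ)σ(μ+ω)/((μ+γ1)(μ+σ)), M3 = κσ(μ+ω)/((μ+γ2+τ)(μ+σ)), M4 = κτσ(μ+ω)/((μ+γ2+τ)(μ+γ3+δ)(μ+σ)). Then λ* > 0, and the point (S*,L*,E*,A*,I*,C*,R*) defined by L* = ΠH·l/(λ*(μ+ω) + μ(μ+ω+l)), S* = (μ+ω)L*/l, E* = M1 L* λ*/l, A* = M2 L* λ*/l, I* = M3 L* λ*/l, C* = M4 L* λ*/l, R* = (γ1 M2 + γ2 M3 + γ3 M4) L* λ*/(l μ) has all components positive and makes the right-hand side of each of the seven equations of the COVID-19 model with lockdown equal to zero; i.e., it is an endemic equilibrium. -/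
/-- For `R0 > 1`, the point `(S*,L*,E*,A*,I*,C*,R*)` built from
`λ* = μ(μ+ω)(R0−1)/A` has all components positive and annihilates the right-hand side
of each of the seven equations of the model with lockdown: it is an endemic equilibrium. -/
theorem stmt_15
    (PiH μ β1 σ γ1 γ2 γ3 τ δ l ω ρ κ : ℝ)
    (hPiH : 0 < PiH) (hμ : 0 < μ) (hβ1 : 0 < β1) (hσ : 0 < σ)
    (hγ1 : 0 < γ1) (hγ2 : 0 < γ2) (hγ3 : 0 < γ3) (hτ : 0 < τ)
    (hδ : 0 < δ) (hl : 0 < l) (hω : 0 < ω)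
    (hρ0 : 0 ≤ ρ) (hρ1 : ρ ≤ 1) (hκ0 : 0 < κ) (hκ1 : κ < 1)
    (R0 M1 M2 M3 M4 Acoef : ℝ)
    (hR0 : R0 = β1 * κ * σ / ((μ + σ) * (γ2 + τ + μ))
        + ρ * β1 * (1 - κ) * σ / ((μ + σ) * (γ1 + μ)))
    (hR0gt : 1 < R0)
    (hM1 : M1 = (μ + ω) / (μ + σ))
    (hM2 : M2 = (1 - κ) * σ * (μ + ω) / ((μ + γ1) * (μ + σ)))
    (hM3 : M3 = κ * σ * (μ + ω) / ((μ + γ2 + τ) * (μ + σ)))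
    (hM4 : M4 = κ * τ * σ * (μ + ω) / ((μ + γ2 + τ) * (μ + γ3 + δ) * (μ + σ)))
    (hAcoef : Acoef = μ * M1 + M2 * (μ + γ1) + M3 * (μ + γ2) + γ3 * M4)
    (lam Sstar Lstar Estar Astar Istar Cstar Rstar Nstar : ℝ)
    (hlam : lam = μ * (μ + ω) * (R0 - 1) / Acoef)
    (hLs : Lstar = PiH * l / (lam * (μ + ω) + μ * (μ + ω + l)))
    (hSs : Sstar = (μ + ω) * Lstar / l)
    (hEs : Estar = M1 * Lstar * lam / l)
    (hAs : Astar = M2 * Lstar * lam / l)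
    (hIs : Istar = M3 * Lstar * lam / l)
    (hCs : Cstar = M4 * Lstar * lam / l)
    (hRs : Rstar = (γ1 * M2 + γ2 * M3 + γ3 * M4) * Lstar * lam / (l * μ))
    (hNs : Nstar = Sstar + Lstar + Estar + Astar + Istar + Cstar + Rstar) :
    0 < lam ∧ 0 < Sstar ∧ 0 < Lstar ∧ 0 < Estar ∧ 0 < Astar ∧ 0 < Istar ∧
    0 < Cstar ∧ 0 < Rstar ∧
    PiH + ω * Lstar - β1 * Istar * Sstar / (Nstar - Lstar - Cstar)
      - ρ * β1 * Astar * Sstar / (Nstar - Lstar - Cstar) - μ * Sstar - l * Sstar = 0 ∧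
    l * Sstar - (μ + ω) * Lstar = 0 ∧
    β1 * Istar * Sstar / (Nstar - Lstar - Cstar)
      + ρ * β1 * Astar * Sstar / (Nstar - Lstar - Cstar) - (μ + σ) * Estar = 0 ∧
    (1 - κ) * σ * Estar - (γ1 + μ) * Astar = 0 ∧
    κ * σ * Estar - (γ2 + τ + μ) * Istar = 0 ∧
    τ * Istar - (δ + γ3 + μ) * Cstar = 0 ∧
    γ1 * Astar + γ2 * Istar + γ3 * Cstar - μ * Rstar = 0 := by
  have hk : 0 < 1 - κ := by linarith
  have hM1p : 0 < M1 := by rw [hM1]; positivity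
  have hM2p : 0 < M2 := by rw [hM2]; positivity
  have hM3p : 0 < M3 := by rw [hM3]; positivity
  have hM4p : 0 < M4 := by rw [hM4]; positivity
  have hAp : 0 < Acoef := by rw [hAcoef]; positivity
  have hRp : 0 < R0 - 1 := by linarith
  have hR0p : 0 < R0 := by linarith
  have hlp : 0 < lam := by rw [hlam]; positivity
  have hLp : 0 < Lstar := by rw [hLs]; positivity
  have hSp : 0 < Sstar := by rw [hSs]; positivity
  have hlA : lam * Acoef = μ * (μ + ω) * (R0 - 1) := by
    rw [hlam]; field_simp
  have hLe : Lstar * (lam * (μ + ω) + μ * (μ + ω + l)) = PiH * l := by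
    rw [hLs]; field_simp
  have e1 : (μ + σ) * M1 = μ + ω := by rw [hM1]; field_simp
  have e2 : (γ1 + μ) * M2 = (1 - κ) * σ * M1 := by
    rw [hM2, hM1]; field_simp; ring
  have e3 : (γ2 + τ + μ) * M3 = κ * σ * M1 := by
    rw [hM3, hM1]; field_simp; ring
  have e4 : (δ + γ3 + μ) * M4 = τ * M3 := by
    rw [hM4, hM3]; field_simp; ring
  have eb : β1 * (M3 + ρ * M2) = (μ + ω) * R0 := by
    rw [hR0, hM3, hM2, show γ2 + τ + μ = μ + γ2 + τ by ring, show γ1 + μ = μ + γ1 by ring]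
    field_simp
  have hD : Nstar - Lstar - Cstar = Lstar / l * ((μ + ω) * R0) := by
    have h : Nstar - Lstar - Cstar = Lstar / l * ((μ + ω) + lam * Acoef / μ) := by
      rw [hNs, hSs, hEs, hAs, hIs, hCs, hRs, hAcoef]; field_simp; ring
    rw [h, hlA]; field_simp; ring
  have hF : β1 * Istar * Sstar / (Nstar - Lstar - Cstar)
      + ρ * β1 * Astar * Sstar / (Nstar - Lstar - Cstar) = (μ + ω) * Lstar * lam / l := by
    rw [← add_div, hD]
    have h : β1 * Istar * Sstar + ρ * β1 * Astar * Sstar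
        = (β1 * (M3 + ρ * M2)) * (Lstar * lam / l) * Sstar := by
      rw [hIs, hAs]; ring
    rw [h, eb, hSs]; field_simp
  refine ⟨hlp, hSp, hLp, by rw [hEs]; positivity, by rw [hAs]; positivity,
    by rw [hIs]; positivity, by rw [hCs]; positivity, by rw [hRs]; positivity,
    ?_, ?_, ?_, ?_, ?_, ?_, ?_⟩
  · have h : PiH = Lstar * (lam * (μ + ω) + μ * (μ + ω + l)) / l := by
      rw [hLe]; field_simp
    have h2 : PiH + ω * Lstar - (μ + ω) * Lstar * lam / l - μ * Sstar - l * Sstar = 0 := by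
      rw [h, hSs]; field_simp; ring
    linarith
  · rw [hSs]; field_simp; ring
  · rw [hF, hEs, ← e1]; ring
  · rw [hEs, hAs]; linear_combination (-(Lstar * lam / l)) * e2
  · rw [hEs, hIs]; linear_combination (-(Lstar * lam / l)) * e3
  · rw [hIs, hCs]; linear_combination (-(Lstar * lam / l)) * e4
  · rw [hAs, hIs, hCs, hRs]; field_simp; ring
end

section
/- Let β1* = (μ+σ)(γ1+μ)(γ2+τ+μ)/(κσ(γ1+μ) + (1−κ)ρσ(γ2+τ+μ)) (assuming the denominator is positive), and let J* be the 7×7 real matrix with rows (−(μ+l), ω, 0, −ρβ1*, −β1*, 0, 0), (l, −(μ+ω), 0, 0, 0, 0, 0), (0, 0, −(μ+σ), ρβ1*, β1*, 0, 0), (0, 0, (1−κ)σ, −(μ+γ1), 0, 0, 0), (0, 0, κσ, 0, −(μ+γ2+τ), 0, 0), (0, 0, 0, 0, τ, −(μ+γ3+δ), 0), (0, 0, 0, γ1, γ2, γ3, −μ). Define the vector w ∈ ℝ^7 by w1 = −(μ+σ)(μ+ω)/(μ(μ+ω+l)), w2 = −(μ+σ)l/(μ(μ+ω+l)), w3 =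 1, w4 = (1−κ)σ/(μ+γ1), w5 = κσ/(μ+γ2+τ), w6 = κστ/((μ+γ2+τ)(μ+γ3+δ)), w7 = γ1(1−κ)σ/(μ(γ1+μ)) + γ2κσ/(μ(γ2+τ+μ)) + γ3τκσ/(μ(γ2+τ+μ)(δ+γ3+μ)). Then J*·w = 0, i.e., w is a right eigenvector of J* corresponding to the eigenvalue zero. -/
/-- The vector `w` is a right eigenvector of the Jacobian `J*` (at the DFE, evaluated at
the critical transmission rate `β1*`) corresponding to the eigenvalue zero: `J*·w = 0`. -/
theorem stmt_17
    (μ σ γ1 γ2 γ3 τ δ l ω ρ κ : ℝ)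
    (hμ : 0 < μ) (hσ : 0 < σ) (hγ1 : 0 < γ1) (hγ2 : 0 < γ2) (hγ3 : 0 < γ3)
    (hτ : 0 < τ) (hδ : 0 < δ) (hl : 0 < l) (hω : 0 < ω)
    (hρ0 : 0 ≤ ρ) (hρ1 : ρ ≤ 1) (hκ0 : 0 < κ) (hκ1 : κ < 1)
    (hden : 0 < κ * σ * (γ1 + μ) + (1 - κ) * ρ * σ * (γ2 + τ + μ))
    (β1star : ℝ)
    (hβ1star : β1star = (μ + σ) * (γ1 + μ) * (γ2 + τ + μ)
        / (κ * σ * (γ1 + μ) + (1 - κ) * ρ * σ * (γ2 + τ + μ)))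
    (Jstar : Matrix (Fin 7) (Fin 7) ℝ)
    (hJ : Jstar = !![-(μ + l), ω, 0, -(ρ * β1star), -β1star, 0, 0;
                     l, -(μ + ω), 0, 0, 0, 0, 0;
                     0, 0, -(μ + σ), ρ * β1star, β1star, 0, 0;
                     0, 0, (1 - κ) * σ, -(μ + γ1), 0, 0, 0;
                     0, 0, κ * σ, 0, -(μ + γ2 + τ), 0, 0;
                     0, 0, 0, 0, τ, -(μ + γ3 + δ), 0;
                     0, 0, 0, γ1, γ2, γ3, -μ])
    (w : Fin 7 → ℝ)
    (hw : w = ![-((μ + σ) * (μ + ω) / (μ * (μ + ω + l))),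
                -((μ + σ) * l / (μ * (μ + ω + l))),
                1,
                (1 - κ) * σ / (μ + γ1),
                κ * σ / (μ + γ2 + τ),
                κ * σ * τ / ((μ + γ2 + τ) * (μ + γ3 + δ)),
                γ1 * (1 - κ) * σ / (μ * (γ1 + μ)) + γ2 * κ * σ / (μ * (γ2 + τ + μ))
                  + γ3 * τ * κ * σ / (μ * (γ2 + τ + μ) * (δ + γ3 + μ))]) :
    Jstar.mulVec w = 0 := by
  have ea : μ + γ1 = γ1 + μ := by ring
  have eb : μ + γ2 + τ = γ2 + τ + μ := by ring
  have ec : μ + γ3 + δ = δ + γ3 + μ := by ring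
  have ha : γ1 + μ ≠ 0 := by positivity
  have hb : γ2 + τ + μ ≠ 0 := by positivity
  have hc : δ + γ3 + μ ≠ 0 := by positivity
  have hd : μ + ω + l ≠ 0 := by positivity
  have hμ' : μ ≠ 0 := hμ.ne'
  rw [ea, eb, ec] at hw hJ
  have key : ρ * β1star * ((1 - κ) * σ / (γ1 + μ)) + β1star * (κ * σ / (γ2 + τ + μ))
      = μ + σ := by
    have h1 : β1star * (κ * σ * (γ1 + μ) + (1 - κ) * ρ * σ * (γ2 + τ + μ))
        = (μ + σ) * (γ1 + μ) * (γ2 + τ + μ) := by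
      rw [hβ1star]; exact div_mul_cancel₀ _ hden.ne'
    generalize γ1 + μ = a at *
    generalize γ2 + τ + μ = b at *
    field_simp
    linear_combination h1
  have row1 : (μ + l) * ((μ + σ) * (μ + ω) / (μ * (μ + ω + l)))
      - ω * ((μ + σ) * l / (μ * (μ + ω + l))) = μ + σ := by
    field_simp
    ring
  clear hβ1star hden
  subst hJ hw
  generalize γ1 + μ = a at *
  generalize γ2 + τ + μ = b at *
  generalize δ + γ3 + μ = c at *
  funext i
  fin_cases i <;> simp [Matrix.mulVec, dotProduct, Fin.sum_univ_succ]
  · linear_combination row1 - key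
  · ring
  · linear_combination key
  · field_simp
    ring
  · field_simp
    ring
  · field_simp
    ring
  · field_simp
    ring
end
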